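/- arXiv:1108.2875 — 14 statements merged into one kernel-verified Lean document; each statement's English description precedes it below -/
import Mathlib

section
/- Let q, r : ℝ² → ℂ be twice continuously differentiable and fix a point (x,t) ∈ ℝ². Then the zero-curvature equation ∂_t L(x,t,k) − ∂_x Z(x,t,k) + L(x,t,k)Z(x,t,k) − Z(x,t,k)L(x,t,k) = 0 holds for every k ∈ ℂ if and only if the system i ∂_t q + (1/√3) ∂_x² q + 2 i r ∂_x r = 0 and i ∂_t r − (1/√3) ∂_x² r + 2 i q ∂_x q = 0 holds at (x,t). (That is, the system is the compatibility condition of the Lax pair ψ_x = Lψ, ψ_t = Zψ.) -/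
open Matrix Complex

noncomputable section

/-- ω = e^{2πi/3}, a primitive third root of unity. -/
def ω : ℂ := Complex.exp (2 * Real.pi * Complex.I / 3)

/-- Jmat = diag(1, ω², ω). -/
def Jmat : Matrix (Fin 3) (Fin 3) ℂ := Matrix.diagonal ![1, ω ^ 2, ω]

def V1 (q r : ℂ) : Matrix (Fin 3) (Fin 3) ℂ := !![0, q, r; r, 0, q; q, r, 0]

def V21 (q r : ℂ) : Matrix (Fin 3) (Fin 3) ℂ :=
  !![0, ω * q, ω ^ 2 * r; ω * r, 0, q; ω ^ 2 * q, r, 0]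

def V20 (q r qx rx : ℂ) : Matrix (Fin 3) (Fin 3) ℂ :=
  (Complex.I / (Real.sqrt 3 : ℂ)) • !![0, qx, -rx; -rx, 0, qx; qx, -rx, 0]
    - !![0, r ^ 2, q ^ 2; q ^ 2, 0, r ^ 2; r ^ 2, q ^ 2, 0]

/-- L(k) = kJ + V₁. -/
def LaxL (q r k : ℂ) : Matrix (Fin 3) (Fin 3) ℂ := k • Jmat + V1 q r

/-- Z(k) = −k²Jmat² + k V₂⁽¹⁾ + V₂⁽⁰⁾. -/
def LaxZ (q r qx rx k : ℂ) : Matrix (Fin 3) (Fin 3) ℂ :=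
  (-(k ^ 2)) • (Jmat * Jmat) + k • V21 q r + V20 q r qx rx

lemma om_rel : ω ^ 2 + ω + 1 = 0 ∧ Complex.I / (Real.sqrt 3 : ℂ) = (2 * ω + 1) / 3 := by
  have h3 : ((Real.sqrt 3 : ℝ) : ℂ) ^ 2 = 3 := by
    norm_cast
    rw [Real.sq_sqrt (by norm_num)]
  have h0 : ((Real.sqrt 3 : ℝ) : ℂ) ≠ 0 := by
    intro h
    rw [h] at h3
    norm_num at h3
  have hw : ω = -1 / 2 + (Real.sqrt 3 : ℂ) / 2 * Complex.I := by
    have e : (2 * Real.pi * Complex.I / 3 : ℂ) = ((Real.pi - Real.pi / 3 : ℝ) : ℂ) * Complex.I := by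
      push_cast
      ring
    unfold ω
    rw [e, Complex.exp_mul_I, ← Complex.ofReal_cos, ← Complex.ofReal_sin, Real.cos_pi_sub,
      Real.sin_pi_sub, Real.cos_pi_div_three, Real.sin_pi_div_three]
    push_cast
    ring
  have hI := Complex.I_sq
  constructor
  · rw [hw]
    linear_combination (1 / 4 * Complex.I ^ 2) * h3 + 3 / 4 * hI
  · rw [hw]
    field_simp
    linear_combination (-Complex.I) * h3

lemma hasDeriv_L (a b : ℝ → ℂ) (a' b' k : ℂ) (x : ℝ) (ha : HasDerivAt a a' x)
    (hb : HasDerivAt b b' x) (i j : Fin 3) :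
    deriv (fun y => LaxL (a y) (b y) k i j) x = a' * V1 1 0 i j + b' * V1 0 1 i j := by
  have e : (fun y => LaxL (a y) (b y) k i j) =
      fun y => k * Jmat i j + (a y * V1 1 0 i j + b y * V1 0 1 i j) := by
    funext y
    fin_cases i <;> fin_cases j <;> simp [LaxL, V1]
  rw [e]
  exact (((ha.mul_const _).add (hb.mul_const _)).const_add _).deriv

lemma hasDeriv_Z (a b c d : ℝ → ℂ) (a' b' c' d' k : ℂ) (x : ℝ) (ha : HasDerivAt a a' x)
    (hb : HasDerivAt b b' x) (hc : HasDerivAt c c' x) (hd : HasDerivAt d d' x) (i j : Fin 3) :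
    deriv (fun y => LaxZ (a y) (b y) (c y) (d y) k i j) x =
      a' * (k * V21 1 0 i j) + b' * (k * V21 0 1 i j) + c' * V20 0 0 1 0 i j
        + d' * V20 0 0 0 1 i j + (a' * a x + a x * a') * V20 1 0 0 0 i j
        + (b' * b x + b x * b') * V20 0 1 0 0 i j := by
  have e : (fun y => LaxZ (a y) (b y) (c y) (d y) k i j) =
      fun y => (-(k ^ 2)) * (Jmat * Jmat) i j +
       (a y * (k * V21 1 0 i j) + b y * (k * V21 0 1 i j) + c y * V20 0 0 1 0 i j
        + d y * V20 0 0 0 1 i j + (a y * a y) * V20 1 0 0 0 i j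
        + (b y * b y) * V20 0 1 0 0 i j) := by
    funext y
    fin_cases i <;> fin_cases j <;> simp [LaxZ, V21, V20] <;> ring
  rw [e]
  exact (((((((ha.mul_const _).add (hb.mul_const _)).add (hc.mul_const _)).add
    (hd.mul_const _)).add ((ha.mul ha).mul_const _)).add ((hb.mul hb).mul_const _)).const_add _).deriv

lemma alg (q r qt rt qx rx qxx rxx k : ℂ) (hw : ω ^ 2 + ω + 1 = 0)
    (hs : Complex.I / (Real.sqrt 3 : ℂ) = (2 * ω + 1) / 3) (i j : Fin 3) :
    (qt * V1 1 0 i j + rt * V1 0 1 i j) -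
     (qx * (k * V21 1 0 i j) + rx * (k * V21 0 1 i j) + qxx * V20 0 0 1 0 i j
        + rxx * V20 0 0 0 1 i j + (qx * q + q * qx) * V20 1 0 0 0 i j
        + (rx * r + r * rx) * V20 0 1 0 0 i j)
     + (LaxL q r k * LaxZ q r qx rx k - LaxZ q r qx rx k * LaxL q r k) i j
    = (qt - (Complex.I / (Real.sqrt 3 : ℂ)) * qxx + 2 * r * rx) * V1 1 0 i j
     + (rt + (Complex.I / (Real.sqrt 3 : ℂ)) * rxx + 2 * q * qx) * V1 0 1 i j := by
  unfold LaxL LaxZ V20 V21 V1 Jmat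
  rw [hs]
  generalize ω = w at *
  have h2 : w ^ 2 = -1 - w := by linear_combination hw
  rw [h2]
  fin_cases i <;> fin_cases j <;>
    simp [Matrix.mul_apply, Fin.sum_univ_three] <;> grind

lemma slice_x (q : ℝ × ℝ → ℂ) (hq : ContDiff ℝ 2 q) (t x : ℝ) :
    HasDerivAt (fun y : ℝ => q (y, t)) (deriv (fun y : ℝ => q (y, t)) x) x ∧
    HasDerivAt (fun x' : ℝ => deriv (fun y : ℝ => q (y, t)) x')
      (deriv (fun x' : ℝ => deriv (fun y : ℝ => q (y, t)) x') x) x := by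
  have h : ContDiff ℝ 2 (fun y : ℝ => q (y, t)) := hq.comp (by fun_prop)
  refine ⟨(h.differentiable (by norm_num) x).hasDerivAt, ?_⟩
  have h' : ContDiff ℝ (1 + 1) (fun y : ℝ => q (y, t)) := by
    rw [one_add_one_eq_two]
    exact h
  have := (contDiff_succ_iff_deriv.1 h').2.2
  exact (this.differentiable (by norm_num) x).hasDerivAt

lemma slice_t (q : ℝ × ℝ → ℂ) (hq : ContDiff ℝ 2 q) (x t : ℝ) :
    HasDerivAt (fun y : ℝ => q (x, y)) (deriv (fun y : ℝ => q (x, y)) t) t := by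
  have h : ContDiff ℝ 2 (fun y : ℝ => q (x, y)) := hq.comp (by fun_prop)
  exact (h.differentiable (by norm_num) t).hasDerivAt

/-- The zero-curvature equation L_t − Z_x + LZ − ZL = 0 (for all k) holds at (x,t) iff the
system iq_t + (1/√3) q_{xx} + 2irr_x = 0, ir_t − (1/√3) r_{xx} + 2iqq_x = 0 holds at (x,t). -/
theorem zero_curvature_iff_system
    (q r : ℝ × ℝ → ℂ) (hq : ContDiff ℝ 2 q) (hr : ContDiff ℝ 2 r) (x t : ℝ) :
    (∀ k : ℂ, ∀ i j : Fin 3,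
        deriv (fun t' : ℝ => LaxL (q (x, t')) (r (x, t')) k i j) t
          - deriv (fun x' : ℝ =>
              LaxZ (q (x', t)) (r (x', t))
                (deriv (fun y : ℝ => q (y, t)) x') (deriv (fun y : ℝ => r (y, t)) x') k i j) x
          + (LaxL (q (x, t)) (r (x, t)) k *
                LaxZ (q (x, t)) (r (x, t))
                  (deriv (fun y : ℝ => q (y, t)) x) (deriv (fun y : ℝ => r (y, t)) x) k
              - LaxZ (q (x, t)) (r (x, t))
                  (deriv (fun y : ℝ => q (y, t)) x) (deriv (fun y : ℝ => r (y, t)) x) k *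
                LaxL (q (x, t)) (r (x, t)) k) i j = 0)
    ↔ (Complex.I * deriv (fun t' : ℝ => q (x, t')) t
          + (1 / (Real.sqrt 3 : ℂ)) * deriv (fun x' : ℝ => deriv (fun y : ℝ => q (y, t)) x') x
          + 2 * Complex.I * r (x, t) * deriv (fun y : ℝ => r (y, t)) x = 0
        ∧ Complex.I * deriv (fun t' : ℝ => r (x, t')) t
          - (1 / (Real.sqrt 3 : ℂ)) * deriv (fun x' : ℝ => deriv (fun y : ℝ => r (y, t)) x') x
          + 2 * Complex.I * q (x, t) * deriv (fun y : ℝ => q (y, t)) x = 0) := by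
  obtain ⟨hw, hs⟩ := om_rel
  obtain ⟨q1, q2⟩ := slice_x q hq t x
  obtain ⟨r1, r2⟩ := slice_x r hr t x
  have q3 := slice_t q hq x t
  have r3 := slice_t r hr x t
  have hL := fun (k : ℂ) (i j : Fin 3) => hasDeriv_L _ _ _ _ k t q3 r3 i j
  have hZ := fun (k : ℂ) (i j : Fin 3) => hasDeriv_Z _ _ _ _ _ _ _ _ k x q1 r1 q2 r2 i j
  simp only [hL, hZ]
  simp only [fun (qt rt qx rx qxx rxx k : ℂ) (i j : Fin 3) =>
    alg (q (x, t)) (r (x, t)) qt rt qx rx qxx rxx k hw hs i j]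
  have hI := Complex.I_sq
  constructor
  · intro h
    have h1 := h 0 0 1
    have h2 := h 0 0 2
    simp only [V1, Matrix.of_apply, Matrix.cons_val] at h1 h2
    constructor
    · linear_combination Complex.I * h1 + (1 / (Real.sqrt 3 : ℂ)) * deriv (fun x' : ℝ => deriv (fun y : ℝ => q (y, t)) x') x * hI
    · linear_combination Complex.I * h2 + (-(1 / (Real.sqrt 3 : ℂ)) * deriv (fun x' : ℝ => deriv (fun y : ℝ => r (y, t)) x') x) * hI
  · rintro ⟨h1, h2⟩ k i j
    have e1 : deriv (fun t' : ℝ => q (x, t')) t - (Complex.I / (Real.sqrt 3 : ℂ)) * deriv (fun x' : ℝ => deriv (fun y : ℝ => q (y, t)) x') x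
        + 2 * r (x, t) * deriv (fun y : ℝ => r (y, t)) x = 0 := by linear_combination (-Complex.I) * h1 + (deriv (fun t' : ℝ => q (x, t')) t + 2 * r (x, t) * deriv (fun y : ℝ => r (y, t)) x) * hI
    have e2 : deriv (fun t' : ℝ => r (x, t')) t + (Complex.I / (Real.sqrt 3 : ℂ)) * deriv (fun x' : ℝ => deriv (fun y : ℝ => r (y, t)) x') x
        + 2 * q (x, t) * deriv (fun y : ℝ => q (y, t)) x = 0 := by linear_combination (-Complex.I) * h2 + (deriv (fun t' : ℝ => r (x, t')) t + 2 * q (x, t) * deriv (fun y : ℝ => q (y, t)) x) * hI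
    rw [e1, e2]
    ring
end
end

section
/- Let 𝒜 = [[0,1,0],[0,0,1],[1,0,0]]. For all q, r, q_x, r_x ∈ ℂ and all k ∈ ℂ one has 𝒜 L(ωk) 𝒜⁻¹ = L(k) and 𝒜 Z(ωk) 𝒜⁻¹ = Z(k). -/
open Matrix Complex

noncomputable section

/-- 𝒜 = [[0,1,0],[0,0,1],[1,0,0]]. -/
def 𝓐 : Matrix (Fin 3) (Fin 3) ℂ := !![0, 1, 0; 0, 0, 1; 1, 0, 0]

/-- The ℤ₃ symmetry: 𝒜 L(ωk) 𝒜⁻¹ = L(k) and 𝒜 Z(ωk) 𝒜⁻¹ = Z(k). -/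
theorem Z3_symmetry (q r qx rx k : ℂ) :
    𝓐 * LaxL q r (ω * k) * 𝓐⁻¹ = LaxL q r k ∧
    𝓐 * LaxZ q r qx rx (ω * k) * 𝓐⁻¹ = LaxZ q r qx rx k := by
  have hinv : 𝓐⁻¹ = 𝓐ᵀ := by
    apply Matrix.inv_eq_right_inv
    ext i j
    fin_cases i <;> fin_cases j <;> simp [𝓐, Matrix.mul_apply, Fin.sum_univ_three]
  have h3 : ω ^ 3 = 1 := by
    rw [ω, ← Complex.exp_nat_mul, ← Complex.exp_two_pi_mul_I]
    congr 1
    push_cast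
    ring
  have hc : ∀ (M : Matrix (Fin 3) (Fin 3) ℂ) (i j : Fin 3),
      (𝓐 * M * 𝓐⁻¹) i j = M (i + 1) (j + 1) := by
    intro M i j
    rw [hinv, Matrix.mul_apply, Fin.sum_univ_three]
    simp only [Matrix.mul_apply, Fin.sum_univ_three, Matrix.transpose_apply]
    fin_cases i <;> fin_cases j <;> simp [𝓐]
  constructor
  · ext i j
    rw [hc]
    fin_cases i <;> fin_cases j <;>
      simp [LaxL, Jmat, V1] <;> grind
  · ext i j
    rw [hc]
    fin_cases i <;> fin_cases j <;>
      simp [LaxZ, Jmat, V21, V20] <;> grind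
end
end

section
/- Let ℬ = [[1,0,0],[0,0,1],[0,1,0]]. Suppose r = q̄ and r_x = conj(q_x), where q, q_x ∈ ℂ. Then for all k ∈ ℂ one has ℬ · conj(L(k̄)) · ℬ⁻¹ = L(k) and ℬ · conj(Z(k̄)) · ℬ⁻¹ = Z(k), where conj denotes entrywise complex conjugation of a matrix and k̄ the complex conjugate of k. -/
open Matrix Complex

noncomputable section

/-- ℬ = [[1,0,0],[0,0,1],[0,1,0]]. -/
def 𝓑 : Matrix (Fin 3) (Fin 3) ℂ := !![1, 0, 0; 0, 0, 1; 0, 1, 0]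

lemma om_cube : ω ^ 3 = 1 := by
  unfold ω
  rw [← Complex.exp_nat_mul, ← Complex.exp_two_pi_mul_I]
  congr 1
  push_cast
  ring

lemma om_conj : (starRingEnd ℂ) ω = ω ^ 2 := by
  have h1 : (starRingEnd ℂ) ω * ω = 1 := by
    unfold ω
    rw [← Complex.exp_conj, ← Complex.exp_add, ← Complex.exp_zero]
    congr 1
    simp only [map_div₀, map_mul, Complex.conj_I, Complex.conj_ofReal, map_ofNat]
    ring
  have h3 := om_cube
  calc (starRingEnd ℂ) ω = (starRingEnd ℂ) ω * ω ^ 3 := by rw [h3, mul_one]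
    _ = ((starRingEnd ℂ) ω * ω) * ω ^ 2 := by ring
    _ = ω ^ 2 := by rw [h1, one_mul]

lemma om_four : (ω ^ 2) ^ 2 = ω := by
  have h3 := om_cube
  linear_combination ω * h3

lemma B_inv : 𝓑⁻¹ = 𝓑 := by
  apply Matrix.inv_eq_right_inv
  ext i j
  fin_cases i <;> fin_cases j <;> simp [𝓑, Matrix.mul_apply, Fin.sum_univ_three]

lemma B_conj (M : Matrix (Fin 3) (Fin 3) ℂ) : 𝓑 * M * 𝓑 =
    !![M 0 0, M 0 2, M 0 1; M 2 0, M 2 2, M 2 1; M 1 0, M 1 2, M 1 1] := by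
  rw [Matrix.eta_fin_three M]
  ext i j
  fin_cases i <;> fin_cases j <;> simp [𝓑]

/-- The ℤ₂ symmetry when r = q̄, r_x = conj(q_x):
ℬ conj(L(k̄)) ℬ⁻¹ = L(k) and ℬ conj(Z(k̄)) ℬ⁻¹ = Z(k). -/
theorem Z2_symmetry (q qx : ℂ) (k : ℂ) :
    𝓑 * (LaxL q ((starRingEnd ℂ) q) ((starRingEnd ℂ) k)).map (starRingEnd ℂ) * 𝓑⁻¹
        = LaxL q ((starRingEnd ℂ) q) k ∧
    𝓑 * (LaxZ q ((starRingEnd ℂ) q) qx ((starRingEnd ℂ) qx) ((starRingEnd ℂ) k)).map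
          (starRingEnd ℂ) * 𝓑⁻¹
        = LaxZ q ((starRingEnd ℂ) q) qx ((starRingEnd ℂ) qx) k := by
  have h4 := om_four
  have hc := om_conj
  rw [B_inv, B_conj, B_conj]
  constructor
  · ext i j
    fin_cases i <;> fin_cases j <;>
      simp [𝓑, LaxL, Jmat, V1, hc, h4]
  · ext i j
    fin_cases i <;> fin_cases j <;>
      simp [𝓑, LaxZ, Jmat, V21, V20, hc, h4] <;> try ring
end
end

section
/- Fix k ∈ ℂ and let l₁, l₂, l₃ and z₁, z₂, z₃ be the diagonal entries of 𝓛 = kJ and 𝓩 = −k²J² respectively. Let q, r : ℝ² → ℂ be continuously differentiable and let μ : ℝ² → M₃(ℂ) be differentiable. Define ψ(x,t) = μ(x,t) · diag(e^{l₁x+z₁t}, e^{l₂x+z₂t}, e^{l₃x+z₃t}). Then at any point (x,t): ψ satisfies ψ_x = Lψ and ψ_t = Zψ if and only if μ satisfies μ_x − [𝓛, μ] = V₁ μ and μ_t − [𝓩, μ] = V₂ μ, where V₂ = k V₂⁽¹⁾ + V₂⁽⁰⁾ and [A,B] = AB − BA. -/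
open Matrix Complex

noncomputable section

/-- l_j(k) = k J_{jj}, the diagonal entries of 𝓛 = kJ. -/
def l (k : ℂ) (j : Fin 3) : ℂ := k * (![1, ω ^ 2, ω] j)

/-- z_j(k) = −k² (J_{jj})², the diagonal entries of 𝓩 = −k²J². -/
def z (k : ℂ) (j : Fin 3) : ℂ := (-(k ^ 2)) * (![1, ω ^ 2, ω] j) ^ 2

/-- E(x,t,k) = diag(e^{l₁x+z₁t}, e^{l₂x+z₂t}, e^{l₃x+z₃t}). -/
def E (k : ℂ) (x t : ℝ) : Matrix (Fin 3) (Fin 3) ℂ :=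
  Matrix.diagonal fun j => Complex.exp (l k j * (x : ℂ) + z k j * (t : ℂ))

theorem mul_E_apply (k : ℂ) (x t : ℝ) (A : Matrix (Fin 3) (Fin 3) ℂ) (i j : Fin 3) :
    (A * E k x t) i j = A i j * Complex.exp (l k j * (x : ℂ) + z k j * (t : ℂ)) := by
  simp only [E, Matrix.mul_diagonal]

theorem mul_kJ_apply (k : ℂ) (A : Matrix (Fin 3) (Fin 3) ℂ) (i j : Fin 3) :
    (A * (k • Jmat)) i j = A i j * l k j := by
  simp only [Jmat, l, Matrix.mul_smul, Matrix.smul_apply, Matrix.mul_diagonal, smul_eq_mul]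
  ring

theorem mul_kJJ_apply (k : ℂ) (A : Matrix (Fin 3) (Fin 3) ℂ) (i j : Fin 3) :
    (A * ((-(k ^ 2)) • (Jmat * Jmat))) i j = A i j * z k j := by
  simp only [Jmat, z, Matrix.mul_smul, Matrix.smul_apply, Matrix.diagonal_mul_diagonal,
    Matrix.mul_diagonal, smul_eq_mul]
  ring

theorem deriv_mul_exp_aux (f : ℝ → ℂ) (a b : ℂ) (x : ℝ) (hf : DifferentiableAt ℝ f x) :
    deriv (fun y : ℝ => f y * Complex.exp (a * (y : ℂ) + b)) x
      = (deriv f x + f x * a) * Complex.exp (a * (x : ℂ) + b) := by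
  have h1 : HasDerivAt (fun y : ℝ => a * (y : ℂ) + b) a x := by
    simpa using ((Complex.ofRealCLM.hasDerivAt (x := x)).const_mul a).add_const b
  have h2 := hf.hasDerivAt.mul h1.cexp
  refine h2.deriv.trans ?_
  ring

/-- ψ = μ e^{𝓛x + 𝓩t} satisfies ψ_x = Lψ, ψ_t = Zψ at (x,t) iff μ satisfies
μ_x − [𝓛, μ] = V₁μ, μ_t − [𝓩, μ] = V₂μ at (x,t), where V₂ = kV₂⁽¹⁾ + V₂⁽⁰⁾. -/
theorem gauge_transformed_lax_pair
    (k : ℂ) (q r : ℝ × ℝ → ℂ) (hq : ContDiff ℝ 1 q) (hr : ContDiff ℝ 1 r)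
    (μ : ℝ × ℝ → Matrix (Fin 3) (Fin 3) ℂ)
    (hμ : ∀ i j : Fin 3, Differentiable ℝ fun p : ℝ × ℝ => μ p i j)
    (x t : ℝ) :
    (∀ i j : Fin 3,
        deriv (fun x' : ℝ => (μ (x', t) * E k x' t) i j) x
            = (LaxL (q (x, t)) (r (x, t)) k * (μ (x, t) * E k x t)) i j
      ∧ deriv (fun t' : ℝ => (μ (x, t') * E k x t') i j) t
            = (LaxZ (q (x, t)) (r (x, t))
                  (deriv (fun y : ℝ => q (y, t)) x) (deriv (fun y : ℝ => r (y, t)) x) k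
                * (μ (x, t) * E k x t)) i j)
    ↔ (∀ i j : Fin 3,
        deriv (fun x' : ℝ => μ (x', t) i j) x
            - ((k • Jmat) * μ (x, t) - μ (x, t) * (k • Jmat)) i j
            = (V1 (q (x, t)) (r (x, t)) * μ (x, t)) i j
      ∧ deriv (fun t' : ℝ => μ (x, t') i j) t
            - (((-(k ^ 2)) • (Jmat * Jmat)) * μ (x, t)
                - μ (x, t) * ((-(k ^ 2)) • (Jmat * Jmat))) i j
            = ((k • V21 (q (x, t)) (r (x, t))
                  + V20 (q (x, t)) (r (x, t))
                      (deriv (fun y : ℝ => q (y, t)) x) (deriv (fun y : ℝ => r (y, t)) x))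
                * μ (x, t)) i j) := by
  refine forall_congr' fun i => forall_congr' fun j => ?_
  have hx : DifferentiableAt ℝ (fun x' : ℝ => μ (x', t) i j) x :=
    ((hμ i j).comp (differentiable_id.prodMk (differentiable_const t))) x
  have ht : DifferentiableAt ℝ (fun t' : ℝ => μ (x, t') i j) t :=
    ((hμ i j).comp ((differentiable_const x).prodMk differentiable_id)) t
  have e1 := deriv_mul_exp_aux _ (l k j) (z k j * (t : ℂ)) x hx
  have e2 := deriv_mul_exp_aux _ (z k j) (l k j * (x : ℂ)) t ht
  simp only [add_comm (z k j * _) (l k j * (x : ℂ))] at e2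
  simp only [← Matrix.mul_assoc, mul_E_apply]
  rw [e1, e2, mul_left_inj' (Complex.exp_ne_zero _), mul_left_inj' (Complex.exp_ne_zero _)]
  simp only [LaxL, LaxZ, add_assoc]
  rw [Matrix.add_mul (k • Jmat), Matrix.add_mul (_ • (_ * _)), Matrix.add_apply,
    Matrix.add_apply, Matrix.sub_apply, Matrix.sub_apply, mul_kJ_apply, mul_kJJ_apply]
  refine and_congr ⟨fun h => ?_, fun h => ?_⟩ ⟨fun h => ?_, fun h => ?_⟩ <;>
    linear_combination h
end
end

section
/- Let 𝓛 ∈ M₃(ℂ) be a diagonal matrix with trace 𝓛 = 0, let V₁ : ℝ → M₃(ℂ) be continuous with trace V₁(x) = 0 for all x, and let μ : ℝ → M₃(ℂ) be differentiable with μ(x) invertible for every x and satisfying μ′(x) − [𝓛, μ(x)] = V₁(x) μ(x) for all x. Then the cofactor-matrix function μ^A(x) := (adj μ(x))ᵀ is differentiable and satisfies (μ^A)′(x) + [𝓛, μ^A(x)] = −V₁(x)ᵀ μ^A(x) for all x ∈ ℝ. -/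
open Matrix

/-- If 𝓛 is diagonal and traceless, V₁ is continuous and traceless, μ is invertible and
satisfies μ′ − [𝓛, μ] = V₁μ, then the cofactor matrix μ^A = (adj μ)ᵀ is differentiable and
satisfies (μ^A)′ + [𝓛, μ^A] = −V₁ᵀ μ^A. -/
theorem cofactor_lax_equation
    (𝓛 : Matrix (Fin 3) (Fin 3) ℂ) (h𝓛diag : 𝓛.IsDiag) (h𝓛tr : 𝓛.trace = 0)
    (V₁ : ℝ → Matrix (Fin 3) (Fin 3) ℂ) (hV₁cont : Continuous V₁)
    (hV₁tr : ∀ x : ℝ, (V₁ x).trace = 0)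
    (μ : ℝ → Matrix (Fin 3) (Fin 3) ℂ) (hμinv : ∀ x : ℝ, IsUnit (μ x))
    (hμ : ∀ (x : ℝ) (i j : Fin 3),
      HasDerivAt (fun y : ℝ => μ y i j) (((𝓛 * μ x - μ x * 𝓛) + V₁ x * μ x) i j) x) :
    ∀ (x : ℝ) (i j : Fin 3),
      HasDerivAt (fun y : ℝ => ((μ y).adjugate)ᵀ i j)
        ((-((V₁ x)ᵀ * ((μ x).adjugate)ᵀ)
          - (𝓛 * ((μ x).adjugate)ᵀ - ((μ x).adjugate)ᵀ * 𝓛)) i j) x := by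
  intro x i j
  have h01 : 𝓛 0 1 = 0 := h𝓛diag (by decide)
  have h02 : 𝓛 0 2 = 0 := h𝓛diag (by decide)
  have h10 : 𝓛 1 0 = 0 := h𝓛diag (by decide)
  have h12 : 𝓛 1 2 = 0 := h𝓛diag (by decide)
  have h20 : 𝓛 2 0 = 0 := h𝓛diag (by decide)
  have h21 : 𝓛 2 1 = 0 := h𝓛diag (by decide)
  have hV := hV₁tr x
  have key : ∀ a b c d e f g h : Fin 3, HasDerivAt
      (fun y : ℝ => μ y a b * μ y c d - μ y e f * μ y g h) _ x := fun a b c d e f g h =>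
    ((hμ x a b).mul (hμ x c d)).sub ((hμ x e f).mul (hμ x g h))
  have key2 : ∀ a b c d e f g h : Fin 3, HasDerivAt
      (fun y : ℝ => -(μ y a b * μ y c d) + μ y e f * μ y g h) _ x := fun a b c d e f g h =>
    ((hμ x a b).mul (hμ x c d)).neg.add ((hμ x e f).mul (hμ x g h))
  have hc : ((μ x).adjugate)ᵀ i j * (V₁ x).trace = 0 := by rw [hV, mul_zero]
  simp only [Matrix.adjugate_fin_three, Matrix.trace_fin_three] at hc ⊢
  fin_cases i <;> fin_cases j <;>
    simp [Matrix.mul_apply, Fin.sum_univ_three, h01, h02, h10, h12, h20, h21,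
      -mul_eq_zero] at hc ⊢ <;>
    first
    | (refine (key _ _ _ _ _ _ _ _).congr_deriv ?_
       simp [Matrix.mul_apply, Fin.sum_univ_three, h01, h02, h10, h12, h20, h21]
       linear_combination hc)
    | (refine (key2 _ _ _ _ _ _ _ _).congr_deriv ?_
       simp [Matrix.mul_apply, Fin.sum_univ_three, h01, h02, h10, h12, h20, h21]
       linear_combination hc)
end

section
/- Let s, S, S₁, T₁, R₁ ∈ M₃(ℂ) with T₁ and R₁ invertible, det s = 1 and det S = 1. Assume: (T₁)_{ij} = δ_{ij} for every (i,j) ∈ {(1,1),(1,2),(1,3),(2,2),(2,3),(3,3)}; (R₁)_{21} = (R₁)_{31} = 0; (S₁)_{32} = 0; s = S₁ T₁⁻¹; and S = S₁ R₁⁻¹. If s_{33} ≠ 0 and W₁ := S_{11} m_{11}(s) − S_{21} m_{21}(s) + S_{31} m_{31}(s) ≠ 0, then S₁ = [[S_{11}/W₁, m_{21}(s)/s_{33}, s_{13}], [S_{21}/W₁, m_{11}(s)/s_{33}, s_{23}], [S_{31}/W₁, 0, s_{33}]]. -/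
open Matrix

/-- m₁₁(X): the (1,1) minor of the 3×3 matrix X. -/
def m11 (X : Matrix (Fin 3) (Fin 3) ℂ) : ℂ := X 1 1 * X 2 2 - X 1 2 * X 2 1
/-- m₁₂(X): the (1,2) minor of the 3×3 matrix X. -/
def m12 (X : Matrix (Fin 3) (Fin 3) ℂ) : ℂ := X 1 0 * X 2 2 - X 1 2 * X 2 0
/-- m₁₃(X): the (1,3) minor of the 3×3 matrix X. -/
def m13 (X : Matrix (Fin 3) (Fin 3) ℂ) : ℂ := X 1 0 * X 2 1 - X 1 1 * X 2 0
/-- m₂₁(X): the (2,1) minor of the 3×3 matrix X. -/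
def m21 (X : Matrix (Fin 3) (Fin 3) ℂ) : ℂ := X 0 1 * X 2 2 - X 0 2 * X 2 1
/-- m₂₂(X): the (2,2) minor of the 3×3 matrix X. -/
def m22 (X : Matrix (Fin 3) (Fin 3) ℂ) : ℂ := X 0 0 * X 2 2 - X 0 2 * X 2 0
/-- m₂₃(X): the (2,3) minor of the 3×3 matrix X. -/
def m23 (X : Matrix (Fin 3) (Fin 3) ℂ) : ℂ := X 0 0 * X 2 1 - X 0 1 * X 2 0
/-- m₃₁(X): the (3,1) minor of the 3×3 matrix X. -/
def m31 (X : Matrix (Fin 3) (Fin 3) ℂ) : ℂ := X 0 1 * X 1 2 - X 0 2 * X 1 1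
/-- m₃₂(X): the (3,2) minor of the 3×3 matrix X. -/
def m32 (X : Matrix (Fin 3) (Fin 3) ℂ) : ℂ := X 0 0 * X 1 2 - X 0 2 * X 1 0
/-- m₃₃(X): the (3,3) minor of the 3×3 matrix X. -/
def m33 (X : Matrix (Fin 3) (Fin 3) ℂ) : ℂ := X 0 0 * X 1 1 - X 0 1 * X 1 0

/-- Solution of the matrix factorization problem in D₁: the explicit formula for S₁. -/
theorem S1_formula (s S S₁ T₁ R₁ : Matrix (Fin 3) (Fin 3) ℂ)
    (hT₁ : IsUnit T₁) (hR₁ : IsUnit R₁) (hdets : s.det = 1) (hdetS : S.det = 1)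
    (hT11 : T₁ 0 0 = 1) (hT12 : T₁ 0 1 = 0) (hT13 : T₁ 0 2 = 0)
    (hT22 : T₁ 1 1 = 1) (hT23 : T₁ 1 2 = 0) (hT33 : T₁ 2 2 = 1)
    (hR21 : R₁ 1 0 = 0) (hR31 : R₁ 2 0 = 0)
    (hS32 : S₁ 2 1 = 0)
    (hs : s = S₁ * T₁⁻¹) (hS : S = S₁ * R₁⁻¹)
    (hs33 : s 2 2 ≠ 0)
    (hW₁ : S 0 0 * m11 s - S 1 0 * m21 s + S 2 0 * m31 s ≠ 0) :
    S₁ = !![S 0 0 / (S 0 0 * m11 s - S 1 0 * m21 s + S 2 0 * m31 s), m21 s / s 2 2, s 0 2;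
            S 1 0 / (S 0 0 * m11 s - S 1 0 * m21 s + S 2 0 * m31 s), m11 s / s 2 2, s 1 2;
            S 2 0 / (S 0 0 * m11 s - S 1 0 * m21 s + S 2 0 * m31 s), 0, s 2 2] := by
  have hTd : IsUnit T₁.det := (Matrix.isUnit_iff_isUnit_det _).1 hT₁
  have hRd : IsUnit R₁.det := (Matrix.isUnit_iff_isUnit_det _).1 hR₁
  have e1 : s * T₁ = S₁ := by
    rw [hs, Matrix.mul_assoc, Matrix.nonsing_inv_mul _ hTd, Matrix.mul_one]
  have e2 : S * R₁ = S₁ := by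
    rw [hS, Matrix.mul_assoc, Matrix.nonsing_inv_mul _ hRd, Matrix.mul_one]
  have c0 : ∀ i, S₁ i 0 = s i 0 + s i 1 * T₁ 1 0 + s i 2 * T₁ 2 0 := fun i => by
    rw [← e1]; simp [Matrix.mul_apply, Fin.sum_univ_three, hT11]
  have c1 : ∀ i, S₁ i 1 = s i 1 + s i 2 * T₁ 2 1 := fun i => by
    rw [← e1]; simp [Matrix.mul_apply, Fin.sum_univ_three, hT12, hT22]
  have c2 : ∀ i, S₁ i 2 = s i 2 := fun i => by
    rw [← e1]; simp [Matrix.mul_apply, Fin.sum_univ_three, hT13, hT23, hT33]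
  have d0 : ∀ i, S₁ i 0 = S i 0 * R₁ 0 0 := fun i => by
    rw [← e2]; simp [Matrix.mul_apply, Fin.sum_univ_three, hR21, hR31]
  have hr : R₁ 0 0 * (S 0 0 * m11 s - S 1 0 * m21 s + S 2 0 * m31 s) = 1 := by
    rw [Matrix.det_fin_three] at hdets
    have a0 := (d0 0).symm.trans (c0 0)
    have a1 := (d0 1).symm.trans (c0 1)
    have a2 := (d0 2).symm.trans (c0 2)
    simp only [m11, m21, m31]
    linear_combination hdets + (s 1 1 * s 2 2 - s 1 2 * s 2 1) * a0
      - (s 0 1 * s 2 2 - s 0 2 * s 2 1) * a1 + (s 0 1 * s 1 2 - s 0 2 * s 1 1) * a2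
  have k0 : ∀ i, S₁ i 0 = S i 0 / (S 0 0 * m11 s - S 1 0 * m21 s + S 2 0 * m31 s) := fun i => by
    rw [eq_div_iff hW₁, d0 i, mul_assoc, hr, mul_one]
  have ht := c1 2
  rw [hS32] at ht
  have k1 : S₁ 0 1 = m21 s / s 2 2 := by
    rw [eq_div_iff hs33, c1 0, m21]
    linear_combination -s 0 2 * ht
  have k2 : S₁ 1 1 = m11 s / s 2 2 := by
    rw [eq_div_iff hs33, c1 1, m11]
    linear_combination -s 1 2 * ht
  generalize S 0 0 * m11 s - S 1 0 * m21 s + S 2 0 * m31 s = W at *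
  ext i j
  fin_cases i <;> fin_cases j
  · exact k0 0
  · exact k1
  · exact c2 0
  · exact k0 1
  · exact k2
  · exact c2 1
  · exact k0 2
  · exact hS32
  · exact c2 2
end

section
/- Let s, S, S₂, T₂, R₂ ∈ M₃(ℂ) with T₂ and R₂ invertible, det s = 1 and det S = 1. Assume: (T₂)_{ij} = δ_{ij} for every (i,j) ∈ {(1,1),(1,2),(1,3),(2,2),(2,3),(3,3)}; (R₂)_{21} = 0; (S₂)_{31} = (S₂)_{32} = 0; s = S₂ T₂⁻¹; and S = S₂ R₂⁻¹. If s_{33} ≠ 0 and W₂ := m_{11}(s) m_{22}(S) − m_{21}(s) m_{12}(S) ≠ 0, then S₂ = [[m_{22}(S)/W₂, m_{21}(s)/s_{33}, s_{13}], [m_{12}(S)/W₂, m_{11}(s)/s_{33}, s_{23}], [0, 0, s_{33}]]. -/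
open Matrix

/-- Solution of the matrix factorization problem in D₂: the explicit formula for S₂. -/
theorem S2_formula (s S S₂ T₂ R₂ : Matrix (Fin 3) (Fin 3) ℂ)
    (hT₂ : IsUnit T₂) (hR₂ : IsUnit R₂) (hdets : s.det = 1) (hdetS : S.det = 1)
    (hT11 : T₂ 0 0 = 1) (hT12 : T₂ 0 1 = 0) (hT13 : T₂ 0 2 = 0)
    (hT22 : T₂ 1 1 = 1) (hT23 : T₂ 1 2 = 0) (hT33 : T₂ 2 2 = 1)
    (hR21 : R₂ 1 0 = 0)
    (hS31 : S₂ 2 0 = 0) (hS32 : S₂ 2 1 = 0)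
    (hs : s = S₂ * T₂⁻¹) (hS : S = S₂ * R₂⁻¹)
    (hs33 : s 2 2 ≠ 0)
    (hW₂ : m11 s * m22 S - m21 s * m12 S ≠ 0) :
    S₂ = !![m22 S / (m11 s * m22 S - m21 s * m12 S), m21 s / s 2 2, s 0 2;
            m12 S / (m11 s * m22 S - m21 s * m12 S), m11 s / s 2 2, s 1 2;
            0, 0, s 2 2] := by
  have h1 : s * T₂ = S₂ := by
    rw [hs, Matrix.mul_assoc, Matrix.nonsing_inv_mul _ ((Matrix.isUnit_iff_isUnit_det _).1 hT₂),
      Matrix.mul_one]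
  have h2 : S * R₂ = S₂ := by
    rw [hS, Matrix.mul_assoc, Matrix.nonsing_inv_mul _ ((Matrix.isUnit_iff_isUnit_det _).1 hR₂),
      Matrix.mul_one]
  clear hs hS
  have e1 : ∀ i j, s i 0 * T₂ 0 j + s i 1 * T₂ 1 j + s i 2 * T₂ 2 j = S₂ i j := by
    intro i j
    rw [← h1, Matrix.mul_apply, Fin.sum_univ_three]
  have e2 : ∀ i j, S i 0 * R₂ 0 j + S i 1 * R₂ 1 j + S i 2 * R₂ 2 j = S₂ i j := by
    intro i j
    rw [← h2, Matrix.mul_apply, Fin.sum_univ_three]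
  have c3 : ∀ i, S₂ i 2 = s i 2 := by
    intro i
    rw [← e1, hT13, hT23, hT33]; ring
  have c2 : ∀ i, S₂ i 1 = s i 1 + s i 2 * T₂ 2 1 := by
    intro i
    rw [← e1, hT12, hT22]; ring
  have ht : s 2 1 + s 2 2 * T₂ 2 1 = 0 := by rw [← c2, hS32]
  have a12 : S₂ 0 1 * s 2 2 = m21 s := by
    rw [c2, m21]; linear_combination s 0 2 * ht
  have a22 : S₂ 1 1 * s 2 2 = m11 s := by
    rw [c2, m11]; linear_combination s 1 2 * ht
  have hdT : T₂.det = 1 := by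
    rw [Matrix.det_fin_three, hT11, hT12, hT13, hT22, hT23, hT33]; ring
  have hd : S₂.det = 1 := by rw [← h1, Matrix.det_mul, hdets, hdT, one_mul]
  rw [Matrix.det_fin_three, hS31, hS32, c3 2] at hd
  have hd' : S₂ 0 0 * m11 s - S₂ 1 0 * m21 s = 1 := by
    rw [← a12, ← a22]; linear_combination hd
  have f0 := e2 0 0
  have f1 := e2 1 0
  have f2 := e2 2 0
  rw [hR21] at f0 f1 f2
  rw [hS31] at f2
  have hp : S₂ 0 0 * m12 S - S₂ 1 0 * m22 S = 0 := by
    rw [← f0, ← f1, m12, m22]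
    linear_combination (S 0 2 * S 1 0 - S 0 0 * S 1 2) * f2
  have b1 : S₂ 0 0 = m22 S / (m11 s * m22 S - m21 s * m12 S) := by
    rw [eq_div_iff hW₂]; linear_combination m22 S * hd' - m21 s * hp
  have b2 : S₂ 1 0 = m12 S / (m11 s * m22 S - m21 s * m12 S) := by
    rw [eq_div_iff hW₂]; linear_combination m12 S * hd' - m11 s * hp
  have b3 : S₂ 0 1 = m21 s / s 2 2 := by rw [eq_div_iff hs33, a12]
  have b4 : S₂ 1 1 = m11 s / s 2 2 := by rw [eq_div_iff hs33, a22]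
  rw [← b1, ← b2, ← b3, ← b4, ← c3 0, ← c3 1, ← c3 2]
  ext i j
  fin_cases i <;> fin_cases j <;> simp [hS31, hS32]
end

section
/- Let s, S, S₃, T₃, R₃ ∈ M₃(ℂ) with T₃ and R₃ invertible, det s = 1 and det S = 1. Assume: (T₃)_{ij} = δ_{ij} for every (i,j) ∈ {(1,1),(1,3),(2,1),(2,2),(2,3),(3,3)}; (R₃)_{12} = 0; (S₃)_{31} = (S₃)_{32} = 0; s = S₃ T₃⁻¹; and S = S₃ R₃⁻¹. If s_{33} ≠ 0 and W₃ := m_{22}(s) m_{11}(S) − m_{12}(s) m_{21}(S) ≠ 0, then S₃ = [[m_{22}(s)/s_{33}, m_{21}(S)/W₃, s_{13}], [m_{12}(s)/s_{33}, m_{11}(S)/W₃, s_{23}], [0, 0, s_{33}]]. -/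
open Matrix

/-- Solution of the matrix factorization problem in D₃: the explicit formula for S₃. -/
theorem S3_formula (s S S₃ T₃ R₃ : Matrix (Fin 3) (Fin 3) ℂ)
    (hT₃ : IsUnit T₃) (hR₃ : IsUnit R₃) (hdets : s.det = 1) (hdetS : S.det = 1)
    (hT11 : T₃ 0 0 = 1) (hT13 : T₃ 0 2 = 0) (hT21 : T₃ 1 0 = 0)
    (hT22 : T₃ 1 1 = 1) (hT23 : T₃ 1 2 = 0) (hT33 : T₃ 2 2 = 1)
    (hR12 : R₃ 0 1 = 0)
    (hS31 : S₃ 2 0 = 0) (hS32 : S₃ 2 1 = 0)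
    (hs : s = S₃ * T₃⁻¹) (hS : S = S₃ * R₃⁻¹)
    (hs33 : s 2 2 ≠ 0)
    (hW₃ : m22 s * m11 S - m12 s * m21 S ≠ 0) :
    S₃ = !![m22 s / s 2 2, m21 S / (m22 s * m11 S - m12 s * m21 S), s 0 2;
            m12 s / s 2 2, m11 S / (m22 s * m11 S - m12 s * m21 S), s 1 2;
            0, 0, s 2 2] := by
  have hTd : IsUnit T₃.det := (Matrix.isUnit_iff_isUnit_det _).1 hT₃
  have hRd : IsUnit R₃.det := (Matrix.isUnit_iff_isUnit_det _).1 hR₃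
  have h1 : s * T₃ = S₃ := by rw [hs, Matrix.nonsing_inv_mul_cancel_right _ _ hTd]
  have h2 : S * R₃ = S₃ := by rw [hS, Matrix.nonsing_inv_mul_cancel_right _ _ hRd]
  clear hs hS
  have e : ∀ i j, S₃ i j = s i 0 * T₃ 0 j + s i 1 * T₃ 1 j + s i 2 * T₃ 2 j := by
    intro i j
    rw [← h1, Matrix.mul_apply, Fin.sum_univ_three]
  have f : ∀ i j, S₃ i j = S i 0 * R₃ 0 j + S i 1 * R₃ 1 j + S i 2 * R₃ 2 j := by
    intro i j
    rw [← h2, Matrix.mul_apply, Fin.sum_univ_three]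
  have hTdet : T₃.det = 1 := by
    rw [Matrix.det_fin_three, hT11, hT13, hT21, hT22, hT23, hT33]; ring
  have hd : S₃.det = 1 := by rw [← h1, Matrix.det_mul, hdets, hTdet, one_mul]
  have c02 : S₃ 0 2 = s 0 2 := by rw [e, hT13, hT23, hT33]; ring
  have c12 : S₃ 1 2 = s 1 2 := by rw [e, hT13, hT23, hT33]; ring
  have c22 : S₃ 2 2 = s 2 2 := by rw [e, hT13, hT23, hT33]; ring
  have e0 := e 0 0
  have e1 := e 1 0
  have e2 := e 2 0
  rw [hT11, hT21] at e0 e1 e2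
  rw [hS31] at e2
  have c00 : S₃ 0 0 * s 2 2 = m22 s := by
    unfold m22; linear_combination s 2 2 * e0 - s 0 2 * e2
  have c10 : S₃ 1 0 * s 2 2 = m12 s := by
    unfold m12; linear_combination s 2 2 * e1 - s 1 2 * e2
  have f0 := f 0 1
  have f1 := f 1 1
  have f2 := f 2 1
  rw [hR12] at f0 f1 f2
  rw [hS32] at f2
  have hpq : S₃ 0 1 * m11 S = S₃ 1 1 * m21 S := by
    rw [f0, f1]; unfold m11 m21
    linear_combination (S 0 1 * S 1 2 - S 0 2 * S 1 1) * f2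
  have hk : m22 s * S₃ 1 1 - m12 s * S₃ 0 1 = 1 := by
    rw [Matrix.det_fin_three, hS31, hS32, c22] at hd
    rw [← c00, ← c10]; linear_combination hd
  have g00 : S₃ 0 0 = m22 s / s 2 2 := by rw [eq_div_iff hs33, c00]
  have g10 : S₃ 1 0 = m12 s / s 2 2 := by rw [eq_div_iff hs33, c10]
  have g01 : S₃ 0 1 = m21 S / (m22 s * m11 S - m12 s * m21 S) := by
    rw [eq_div_iff hW₃]; linear_combination m22 s * hpq + m21 S * hk
  have g11 : S₃ 1 1 = m11 S / (m22 s * m11 S - m12 s * m21 S) := by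
    rw [eq_div_iff hW₃]; linear_combination m12 s * hpq + m11 S * hk
  rw [← g00, ← g10, ← g01, ← g11, ← c02, ← c12, ← c22]
  ext i j
  fin_cases i <;> fin_cases j <;> simp [hS31, hS32]
end

section
/- Let s, S, S₄, T₄, R₄ ∈ M₃(ℂ) with T₄ and R₄ invertible, det s = 1 and det S = 1. Assume: (T₄)_{ij} = δ_{ij} for every (i,j) ∈ {(1,1),(1,3),(2,1),(2,2),(2,3),(3,3)}; (R₄)_{12} = (R₄)_{32} = 0; (S₄)_{31} = 0; s = S₄ T₄⁻¹; and S = S₄ R₄⁻¹. If s_{33} ≠ 0 and W₄ := −S_{12} m_{12}(s) + S_{22} m_{22}(s) − S_{32} m_{32}(s) ≠ 0, then S₄ = [[m_{22}(s)/s_{33}, S_{12}/W₄, s_{13}], [m_{12}(s)/s_{33}, S_{22}/W₄, s_{23}], [0, S_{32}/W₄, s_{33}]]. -/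
open Matrix

/-- Solution of the matrix factorization problem in D₄: the explicit formula for S₄. -/
theorem S4_formula (s S S₄ T₄ R₄ : Matrix (Fin 3) (Fin 3) ℂ)
    (hT₄ : IsUnit T₄) (hR₄ : IsUnit R₄) (hdets : s.det = 1) (hdetS : S.det = 1)
    (hT11 : T₄ 0 0 = 1) (hT13 : T₄ 0 2 = 0) (hT21 : T₄ 1 0 = 0)
    (hT22 : T₄ 1 1 = 1) (hT23 : T₄ 1 2 = 0) (hT33 : T₄ 2 2 = 1)
    (hR12 : R₄ 0 1 = 0) (hR32 : R₄ 2 1 = 0)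
    (hS31 : S₄ 2 0 = 0)
    (hs : s = S₄ * T₄⁻¹) (hS : S = S₄ * R₄⁻¹)
    (hs33 : s 2 2 ≠ 0)
    (hW₄ : -(S 0 1) * m12 s + S 1 1 * m22 s - S 2 1 * m32 s ≠ 0) :
    S₄ = !![m22 s / s 2 2, S 0 1 / (-(S 0 1) * m12 s + S 1 1 * m22 s - S 2 1 * m32 s), s 0 2;
            m12 s / s 2 2, S 1 1 / (-(S 0 1) * m12 s + S 1 1 * m22 s - S 2 1 * m32 s), s 1 2;
            0, S 2 1 / (-(S 0 1) * m12 s + S 1 1 * m22 s - S 2 1 * m32 s), s 2 2] := by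
  have e1 : s * T₄ = S₄ := by
    rw [hs, Matrix.mul_assoc, Matrix.nonsing_inv_mul _ ((Matrix.isUnit_iff_isUnit_det _).1 hT₄), Matrix.mul_one]
  have e2 : S * R₄ = S₄ := by
    rw [hS, Matrix.mul_assoc, Matrix.nonsing_inv_mul _ ((Matrix.isUnit_iff_isUnit_det _).1 hR₄), Matrix.mul_one]
  clear hs hS
  have a : ∀ i j, s i 0 * T₄ 0 j + s i 1 * T₄ 1 j + s i 2 * T₄ 2 j = S₄ i j := by
    intro i j
    rw [← e1, Matrix.mul_apply, Fin.sum_univ_three]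
  have b : ∀ i, S i 1 * R₄ 1 1 = S₄ i 1 := by
    intro i
    rw [← e2, Matrix.mul_apply, Fin.sum_univ_three, hR12, hR32]
    ring
  have c2 : ∀ i, S₄ i 2 = s i 2 := by
    intro i
    rw [← a i 2, hT13, hT23, hT33]
    ring
  have c0 : ∀ i, S₄ i 0 = s i 0 + s i 2 * T₄ 2 0 := by
    intro i
    rw [← a i 0, hT11, hT21]
    ring
  have c1 : ∀ i, S i 1 * R₄ 1 1 = s i 0 * T₄ 0 1 + s i 1 + s i 2 * T₄ 2 1 := by
    intro i
    rw [b, ← a i 1, hT22]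
    ring
  have t : s 2 0 + s 2 2 * T₄ 2 0 = 0 := by rw [← c0, hS31]
  rw [Matrix.det_fin_three] at hdets
  have hr : R₄ 1 1 * (-(S 0 1) * m12 s + S 1 1 * m22 s - S 2 1 * m32 s) = 1 := by
    rw [← hdets]
    simp only [m12, m22, m32]
    linear_combination (-(s 1 0 * s 2 2 - s 1 2 * s 2 0)) * c1 0 + (s 0 0 * s 2 2 - s 0 2 * s 2 0) * c1 1 - (s 0 0 * s 1 2 - s 0 2 * s 1 0) * c1 2
  have d1 : ∀ i, S₄ i 1 = S i 1 / (-(S 0 1) * m12 s + S 1 1 * m22 s - S 2 1 * m32 s) := by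
    intro i
    rw [eq_div_iff hW₄, ← b, mul_assoc, hr, mul_one]
  have d00 : S₄ 0 0 = m22 s / s 2 2 := by
    rw [eq_div_iff hs33, c0, m22]
    linear_combination s 0 2 * t
  have d10 : S₄ 1 0 = m12 s / s 2 2 := by
    rw [eq_div_iff hs33, c0, m12]
    linear_combination s 1 2 * t
  ext i j
  fin_cases i <;> fin_cases j
  · exact d00
  · exact d1 0
  · exact c2 0
  · exact d10
  · exact d1 1
  · exact c2 1
  · exact hS31
  · exact d1 2
  · exact c2 2
end

section
/- Let s, ŝ, S ∈ M₃(ℂ). Assume the two relations −s_{13} m_{12}(S) + s_{23} m_{22}(S) − s_{33} m_{32}(S) = 0 and −ŝ_{11} m_{12}(S) + ŝ_{21} m_{22}(S) − ŝ_{31} m_{32}(S) = 0, and assume s_{13} ŝ_{21} − ŝ_{11} s_{23} ≠ 0, s_{33} ≠ 0, W₂ := m_{11}(s) m_{22}(S) − m_{21}(s) m_{12}(S) ≠ 0, and 𝒲₁ := ŝ_{11} m_{11}(s) − ŝ_{21} m_{21}(s) + ŝ_{31} m_{31}(s) ≠ 0. Then m_{22}(S)/W₂ = (ŝ_{11} s_{33}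 − s_{13} ŝ_{31})/(s_{33} 𝒲₁) and m_{12}(S)/W₂ = (ŝ_{21} s_{33} − s_{23} ŝ_{31})/(s_{33} 𝒲₁). (In the paper, ŝ(k) = s(−k), and the two relations are the (2,3) entry of the global relation together with the (2,1) entry at −k combined with the symmetry S(k) = S(−k) induced by vanishing Dirichlet boundary data.) -/
open Matrix

/-- The quotients m₂₂(S)/W₂ and m₁₂(S)/W₂ computed from the global relation and the
symmetry S(k) = S(−k) (here sh stands for s(−k)). -/
theorem D2_quotients (s sh S : Matrix (Fin 3) (Fin 3) ℂ)
    (h1 : -(s 0 2) * m12 S + s 1 2 * m22 S - s 2 2 * m32 S = 0)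
    (h2 : -(sh 0 0) * m12 S + sh 1 0 * m22 S - sh 2 0 * m32 S = 0)
    (hnd : s 0 2 * sh 1 0 - sh 0 0 * s 1 2 ≠ 0)
    (hs33 : s 2 2 ≠ 0)
    (hW₂ : m11 s * m22 S - m21 s * m12 S ≠ 0)
    (h𝒲₁ : sh 0 0 * m11 s - sh 1 0 * m21 s + sh 2 0 * m31 s ≠ 0) :
    m22 S / (m11 s * m22 S - m21 s * m12 S)
        = (sh 0 0 * s 2 2 - s 0 2 * sh 2 0)
            / (s 2 2 * (sh 0 0 * m11 s - sh 1 0 * m21 s + sh 2 0 * m31 s))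
      ∧ m12 S / (m11 s * m22 S - m21 s * m12 S)
        = (sh 1 0 * s 2 2 - s 1 2 * sh 2 0)
            / (s 2 2 * (sh 0 0 * m11 s - sh 1 0 * m21 s + sh 2 0 * m31 s)) := by
  have hI : s 2 2 * (sh 0 0 * m11 s - sh 1 0 * m21 s + sh 2 0 * m31 s)
      = m11 s * (sh 0 0 * s 2 2 - s 0 2 * sh 2 0)
        - m21 s * (sh 1 0 * s 2 2 - s 1 2 * sh 2 0) := by
    simp only [m11, m21, m31]
    ring
  have hd := mul_ne_zero hs33 h𝒲₁
  constructor
  · rw [div_eq_div_iff hW₂ hd, hI]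
    linear_combination m21 s * (sh 2 0 * h1 - s 2 2 * h2)
  · rw [div_eq_div_iff hW₂ hd, hI]
    linear_combination m11 s * (sh 2 0 * h1 - s 2 2 * h2)
end

section
/- Let s, ŝ, S ∈ M₃(ℂ). Assume the two relations s_{13} m_{11}(S) − s_{23} m_{21}(S) + s_{33} m_{31}(S) = 0 and ŝ_{12} m_{11}(S) − ŝ_{22} m_{21}(S) + ŝ_{32} m_{31}(S) = 0, and assume s_{13} ŝ_{22} − ŝ_{12} s_{23} ≠ 0, s_{33} ≠ 0, W₃ := m_{22}(s) m_{11}(S) − m_{12}(s) m_{21}(S) ≠ 0, and 𝒲₄ := −ŝ_{12} m_{12}(s) + ŝ_{22} m_{22}(s) − ŝ_{32} m_{32}(s) ≠ 0. Then m_{11}(S)/W₃ = (s_{23} ŝ_{32} − ŝ_{22} s_{33}) / (s_{33} (ŝ_{12} m_{12}(s) − ŝ_{22} m_{22}(s) + ŝ_{32} m_{32}(s))) and m_{21}(S)/W₃ = (s_{13} ŝ_{32} − ŝ_{12} s_{33}) / (s_{33} (ŝ_{12} m_{12}(s) − ŝ_{22} m_{22}(s) + ŝ_{32} m_{32}(s))).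 (Note the common denominator equals −s_{33} 𝒲₄. In the paper, ŝ(k) = s(−k), and the two relations are the (1,3) entry of the global relation together with the (1,2) entry at −k combined with the symmetry S(k) = S(−k) induced by vanishing Dirichlet boundary data.) -/
open Matrix

/-- The quotients m₁₁(S)/W₃ and m₂₁(S)/W₃ computed from the global relation and the
symmetry S(k) = S(−k) (here sh stands for ŝ, i.e. s(−k)). -/
theorem D3_quotients (s sh S : Matrix (Fin 3) (Fin 3) ℂ)
    (h1 : s 0 2 * m11 S - s 1 2 * m21 S + s 2 2 * m31 S = 0)
    (h2 : sh 0 1 * m11 S - sh 1 1 * m21 S + sh 2 1 * m31 S = 0)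
    (hnd : s 0 2 * sh 1 1 - sh 0 1 * s 1 2 ≠ 0)
    (hs33 : s 2 2 ≠ 0)
    (hW₃ : m22 s * m11 S - m12 s * m21 S ≠ 0)
    (h𝒲₄ : -(sh 0 1) * m12 s + sh 1 1 * m22 s - sh 2 1 * m32 s ≠ 0) :
    m11 S / (m22 s * m11 S - m12 s * m21 S)
        = (s 1 2 * sh 2 1 - sh 1 1 * s 2 2)
            / (s 2 2 * (sh 0 1 * m12 s - sh 1 1 * m22 s + sh 2 1 * m32 s))
      ∧ m21 S / (m22 s * m11 S - m12 s * m21 S)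
        = (s 0 2 * sh 2 1 - sh 0 1 * s 2 2)
            / (s 2 2 * (sh 0 1 * m12 s - sh 1 1 * m22 s + sh 2 1 * m32 s)) := by
  have hE : s 2 2 * m32 s = m22 s * s 1 2 - m12 s * s 0 2 := by
    simp only [m32, m22, m12]; ring
  have hD : sh 0 1 * m12 s - sh 1 1 * m22 s + sh 2 1 * m32 s ≠ 0 := by
    intro h
    apply h𝒲₄
    linear_combination -h
  constructor
  · rw [div_eq_div_iff hW₃ (mul_ne_zero hs33 hD)]
    linear_combination (-m12 s) * (sh 2 1 * h1 - s 2 2 * h2) + m11 S * sh 2 1 * hE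
  · rw [div_eq_div_iff hW₃ (mul_ne_zero hs33 hD)]
    linear_combination (-m22 s) * (sh 2 1 * h1 - s 2 2 * h2) + m21 S * sh 2 1 * hE
end

section
/- Let s, ŝ ∈ M₃(ℂ) with det s = 1, s_{33} ≠ 0, 𝒲₁ := ŝ_{11} m_{11}(s) − ŝ_{21} m_{21}(s) + ŝ_{31} m_{31}(s) ≠ 0, and 𝒲₄ := −ŝ_{12} m_{12}(s) + ŝ_{22} m_{22}(s) − ŝ_{32} m_{32}(s) ≠ 0; note 𝒲₁ = (ŝᵀ s^A)_{11} and 𝒲₄ = (ŝᵀ s^A)_{22}. Define S₂ := [[(ŝ_{11} s_{33} − s_{13} ŝ_{31})/(s_{33} 𝒲₁), m_{21}(s)/s_{33}, s_{13}], [(ŝ_{21} s_{33} − s_{23} ŝ_{31})/(s_{33} 𝒲₁), m_{11}(s)/s_{33}, s_{23}], [0, 0, s_{33}]] and S₃ := [[m_{22}(s)/s_{33}, (s_{13} ŝ_{32} − ŝ_{12} s_{33})/(s_{33}(ŝ_{12} m_{12}(s) − ŝ_{22} m_{22}(s) + ŝ_{32} m_{32}(s))), s_{13}], [m_{12}(s)/s_{33},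 (s_{23} ŝ_{32} − ŝ_{22} s_{33})/(s_{33}(ŝ_{12} m_{12}(s) − ŝ_{22} m_{22}(s) + ŝ_{32} m_{32}(s))), s_{23}], [0, 0, s_{33}]]. Then det S₂ = 1, and S₂⁻¹ S₃ = [[1, (ŝᵀ s^A)_{21}/𝒲₄, 0], [−(ŝᵀ s^A)_{12}/𝒲₁, (𝒲₁ 𝒲₄ − (ŝᵀ s^A)_{21} (ŝᵀ s^A)_{12})/(𝒲₁ 𝒲₄), 0], [0, 0, 1]]. (This is the jump matrix J_{2,3} of the linearizable boundary-condition theorem evaluated at x = t = 0.) -/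
open Matrix

/-- The cofactor matrix X^A, with (X^A)_{ij} = (−1)^{i+j} m_{ij}(X). -/
def cofMat (X : Matrix (Fin 3) (Fin 3) ℂ) : Matrix (Fin 3) (Fin 3) ℂ :=
  !![m11 X, -m12 X, m13 X; -m21 X, m22 X, -m23 X; m31 X, -m32 X, m33 X]

/-- 𝒲₁ = ŝ₁₁m₁₁(s) − ŝ₂₁m₂₁(s) + ŝ₃₁m₃₁(s) = (ŝᵀ s^A)₁₁ (here sh stands for ŝ). -/
def W1 (s sh : Matrix (Fin 3) (Fin 3) ℂ) : ℂ :=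
  sh 0 0 * m11 s - sh 1 0 * m21 s + sh 2 0 * m31 s

/-- 𝒲₄ = −ŝ₁₂m₁₂(s) + ŝ₂₂m₂₂(s) − ŝ₃₂m₃₂(s) = (ŝᵀ s^A)₂₂ (here sh stands for ŝ). -/
def W4 (s sh : Matrix (Fin 3) (Fin 3) ℂ) : ℂ :=
  -(sh 0 1) * m12 s + sh 1 1 * m22 s - sh 2 1 * m32 s

/-- The jump matrix J₂,₃ for linearizable boundary conditions, evaluated at x = t = 0. -/
theorem J23_formula (s sh : Matrix (Fin 3) (Fin 3) ℂ)
    (hdets : s.det = 1) (hs33 : s 2 2 ≠ 0)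
    (h𝒲₁ : W1 s sh ≠ 0) (h𝒲₄ : W4 s sh ≠ 0) :
    (!![(sh 0 0 * s 2 2 - s 0 2 * sh 2 0) / (s 2 2 * W1 s sh), m21 s / s 2 2, s 0 2;
        (sh 1 0 * s 2 2 - s 1 2 * sh 2 0) / (s 2 2 * W1 s sh), m11 s / s 2 2, s 1 2;
        0, 0, s 2 2] : Matrix (Fin 3) (Fin 3) ℂ).det = 1
    ∧ (!![(sh 0 0 * s 2 2 - s 0 2 * sh 2 0) / (s 2 2 * W1 s sh), m21 s / s 2 2, s 0 2;
          (sh 1 0 * s 2 2 - s 1 2 * sh 2 0) / (s 2 2 * W1 s sh), m11 s / s 2 2, s 1 2;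
          0, 0, s 2 2] : Matrix (Fin 3) (Fin 3) ℂ)⁻¹
        * !![m22 s / s 2 2,
              (s 0 2 * sh 2 1 - sh 0 1 * s 2 2)
                / (s 2 2 * (sh 0 1 * m12 s - sh 1 1 * m22 s + sh 2 1 * m32 s)), s 0 2;
             m12 s / s 2 2,
              (s 1 2 * sh 2 1 - sh 1 1 * s 2 2)
                / (s 2 2 * (sh 0 1 * m12 s - sh 1 1 * m22 s + sh 2 1 * m32 s)), s 1 2;
             0, 0, s 2 2]
      = !![1, (shᵀ * cofMat s) 1 0 / W4 s sh, 0;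
           -((shᵀ * cofMat s) 0 1) / W1 s sh,
             (W1 s sh * W4 s sh - (shᵀ * cofMat s) 1 0 * (shᵀ * cofMat s) 0 1)
               / (W1 s sh * W4 s sh), 0;
           0, 0, 1] := by
  have hC : (shᵀ * cofMat s) 1 0 = sh 0 1 * m11 s - sh 1 1 * m21 s + sh 2 1 * m31 s := by
    simp [Matrix.mul_apply, Fin.sum_univ_three, cofMat]; ring
  have hB : (shᵀ * cofMat s) 0 1 = -(sh 0 0 * m12 s) + sh 1 0 * m22 s - sh 2 0 * m32 s := by
    simp [Matrix.mul_apply, Fin.sum_univ_three, cofMat]; ring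
  have hW : sh 0 1 * m12 s - sh 1 1 * m22 s + sh 2 1 * m32 s = -W4 s sh := by
    unfold W4; ring
  rw [hW]
  rw [Matrix.det_fin_three] at hdets
  generalize hCe : (shᵀ * cofMat s) 1 0 = C at *
  generalize hBe : (shᵀ * cofMat s) 0 1 = B at *
  have k1 : W1 s sh * m22 s + B * m21 s = sh 0 0 * s 2 2 - s 0 2 * sh 2 0 := by
    rw [hB]; simp only [W1, m11, m12, m21, m22, m31, m32]
    linear_combination (sh 0 0 * s 2 2 - s 0 2 * sh 2 0) * hdets
  have k2 : W1 s sh * m12 s + B * m11 s = sh 1 0 * s 2 2 - s 1 2 * sh 2 0 := by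
    rw [hB]; simp only [W1, m11, m12, m21, m22, m31, m32]
    linear_combination (sh 1 0 * s 2 2 - s 1 2 * sh 2 0) * hdets
  have k3 : W4 s sh * m21 s + C * m22 s = sh 0 1 * s 2 2 - s 0 2 * sh 2 1 := by
    rw [hC]; simp only [W4, m11, m12, m21, m22, m31, m32]
    linear_combination (sh 0 1 * s 2 2 - s 0 2 * sh 2 1) * hdets
  have k4 : W4 s sh * m11 s + C * m12 s = sh 1 1 * s 2 2 - s 1 2 * sh 2 1 := by
    rw [hC]; simp only [W4, m11, m12, m21, m22, m31, m32]
    linear_combination (sh 1 1 * s 2 2 - s 1 2 * sh 2 1) * hdets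
  have k5 : m11 s * m22 s - m12 s * m21 s = s 2 2 := by
    simp only [m11, m12, m21, m22]
    linear_combination (s 2 2) * hdets
  have e3 : s 0 2 * sh 2 1 - sh 0 1 * s 2 2 = -(W4 s sh * m21 s + C * m22 s) := by rw [k3]; ring
  have e4 : s 1 2 * sh 2 1 - sh 1 1 * s 2 2 = -(W4 s sh * m11 s + C * m12 s) := by rw [k4]; ring
  rw [e3, e4, ← k1, ← k2]
  clear e3 e4 k1 k2 k3 k4 hC hB hCe hBe hW hdets
  generalize W1 s sh = w1 at *
  generalize W4 s sh = w4 at *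
  generalize s 2 2 = d at *
  generalize m11 s = a at *
  generalize m12 s = b at *
  generalize m21 s = c at *
  generalize m22 s = e at *
  generalize s 0 2 = p at *
  generalize s 1 2 = q at *
  have hdet : (!![(w1 * e + B * c) / (d * w1), c / d, p;
      (w1 * b + B * a) / (d * w1), a / d, q; 0, 0, d] : Matrix (Fin 3) (Fin 3) ℂ).det = 1 := by
    rw [Matrix.det_fin_three]
    simp
    field_simp
    linear_combination w1 * k5
  refine ⟨hdet, ?_⟩
  have key : (!![e / d, -(w4 * c + C * e) / (d * -w4), p;
      b / d, -(w4 * a + C * b) / (d * -w4), q; 0, 0, d] : Matrix (Fin 3) (Fin 3) ℂ)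
      = !![(w1 * e + B * c) / (d * w1), c / d, p;
      (w1 * b + B * a) / (d * w1), a / d, q; 0, 0, d] *
      !![1, C / w4, 0; -B / w1, (w1 * w4 - C * B) / (w1 * w4), 0; 0, 0, 1] := by
    ext i j
    fin_cases i <;> fin_cases j <;> simp [Matrix.mul_apply, Fin.sum_univ_three] <;>
      field_simp <;> ring
  rw [key, Matrix.nonsing_inv_mul_cancel_left]
  rw [hdet]; exact isUnit_one
end

section
/- Let s, ŝ, S ∈ M₃(ℂ) with det S = 1. Assume the four relations: s_{13} m_{11}(S) − s_{23} m_{21}(S) + s_{33} m_{31}(S) = 0; ŝ_{12} m_{11}(S) − ŝ_{22} m_{21}(S) + ŝ_{32} m_{31}(S) = 0; s_{11} m_{13}(S) − s_{21} m_{23}(S) + s_{31} m_{33}(S) = 0; ŝ_{12} m_{13}(S) − ŝ_{22} m_{23}(S) + ŝ_{32} m_{33}(S) = 0. Assume also s_{23} ŝ_{12} − s_{13} ŝ_{22} ≠ 0, s_{21} ŝ_{12} − s_{11} ŝ_{22} ≠ 0, W₄ := −S_{12} m_{12}(s) + S_{22} m_{22}(s) − S_{32} m_{32}(s) ≠ 0,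 and 𝒲₄ := −ŝ_{12} m_{12}(s) + ŝ_{22} m_{22}(s) − ŝ_{32} m_{32}(s) ≠ 0. Then S_{32}/W₄ = ŝ_{32}/𝒲₄ and (S_{12} s_{23} − s_{13} S_{22})/W₄ = (ŝ_{12} s_{23} − s_{13} ŝ_{22})/𝒲₄. (These identities replace the unknown matrix S by ŝ in the residue conditions in D₄ for linearizable boundary conditions, where ŝ(k) = s(−k).) -/
open Matrix

/-- Elimination of the unknown matrix S in favour of ŝ (here written sh) in the residue
conditions in D₄ for linearizable boundary conditions. -/
theorem D4_residue_elimination (s sh S : Matrix (Fin 3) (Fin 3) ℂ)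
    (hdetS : S.det = 1)
    (h1 : s 0 2 * m11 S - s 1 2 * m21 S + s 2 2 * m31 S = 0)
    (h2 : sh 0 1 * m11 S - sh 1 1 * m21 S + sh 2 1 * m31 S = 0)
    (h3 : s 0 0 * m13 S - s 1 0 * m23 S + s 2 0 * m33 S = 0)
    (h4 : sh 0 1 * m13 S - sh 1 1 * m23 S + sh 2 1 * m33 S = 0)
    (hnd1 : s 1 2 * sh 0 1 - s 0 2 * sh 1 1 ≠ 0)
    (hnd2 : s 1 0 * sh 0 1 - s 0 0 * sh 1 1 ≠ 0)
    (hW₄ : -(S 0 1) * m12 s + S 1 1 * m22 s - S 2 1 * m32 s ≠ 0)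
    (h𝒲₄ : -(sh 0 1) * m12 s + sh 1 1 * m22 s - sh 2 1 * m32 s ≠ 0) :
    S 2 1 / (-(S 0 1) * m12 s + S 1 1 * m22 s - S 2 1 * m32 s)
        = sh 2 1 / (-(sh 0 1) * m12 s + sh 1 1 * m22 s - sh 2 1 * m32 s)
      ∧ (S 0 1 * s 1 2 - s 0 2 * S 1 1)
            / (-(S 0 1) * m12 s + S 1 1 * m22 s - S 2 1 * m32 s)
        = (sh 0 1 * s 1 2 - s 0 2 * sh 1 1)
            / (-(sh 0 1) * m12 s + sh 1 1 * m22 s - sh 2 1 * m32 s) := by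
  rw [Matrix.det_fin_three] at hdetS
  obtain ⟨c, hc⟩ : ∃ c, c = -(sh 0 1) * m12 S + sh 1 1 * m22 S - sh 2 1 * m32 S := ⟨_, rfl⟩
  have e0 : sh 0 1 = c * S 0 1 := by
    subst hc
    simp only [m11, m12, m13, m21, m22, m23, m31, m32, m33] at *
    linear_combination (-sh 0 1) * hdetS + S 0 0 * h2 + S 0 2 * h4
  have e1 : sh 1 1 = c * S 1 1 := by
    subst hc
    simp only [m11, m12, m13, m21, m22, m23, m31, m32, m33] at *
    linear_combination (-sh 1 1) * hdetS + S 1 0 * h2 + S 1 2 * h4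
  have e2 : sh 2 1 = c * S 2 1 := by
    subst hc
    simp only [m11, m12, m13, m21, m22, m23, m31, m32, m33] at *
    linear_combination (-sh 2 1) * hdetS + S 2 0 * h2 + S 2 2 * h4
  rw [e0, e1, e2] at h𝒲₄ ⊢
  constructor
  · rw [div_eq_div_iff hW₄ h𝒲₄]; ring
  · rw [div_eq_div_iff hW₄ h𝒲₄]; ring
end

section
/- Let s, ŝ, S ∈ M₃(ℂ) with det s = 1 and det S = 1. Assume the four relations: −s_{13} m_{12}(S) + s_{23} m_{22}(S) − s_{33} m_{32}(S) = 0; −ŝ_{11} m_{12}(S) + ŝ_{21} m_{22}(S) − ŝ_{31} m_{32}(S) = 0; s_{12} m_{13}(S) − s_{22} m_{23}(S) + s_{32} m_{33}(S) = 0; ŝ_{11} m_{13}(S) − ŝ_{21} m_{23}(S) + ŝ_{31} m_{33}(S) = 0. Assume also s_{33} ≠ 0, 𝒲₁ := ŝ_{11} m_{11}(s) − ŝ_{21} m_{21}(s) + ŝ_{31} m_{31}(s) ≠ 0, W₁ := S_{11} m_{11}(s) − S_{21} m_{21}(s) + S_{31} m_{31}(s) ≠ 0, W₂ := m_{11}(s)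 m_{22}(S) − m_{21}(s) m_{12}(S) ≠ 0, and the nondegeneracy conditions s_{13} ŝ_{21} − ŝ_{11} s_{23} ≠ 0 and s_{22} ŝ_{11} − s_{12} ŝ_{21} ≠ 0. Define S₁ := [[S_{11}/W₁, m_{21}(s)/s_{33}, s_{13}], [S_{21}/W₁, m_{11}(s)/s_{33}, s_{23}], [S_{31}/W₁, 0, s_{33}]] and S₂ := [[m_{22}(S)/W₂, m_{21}(s)/s_{33}, s_{13}], [m_{12}(S)/W₂, m_{11}(s)/s_{33}, s_{23}], [0, 0, s_{33}]]. Then S₁ is invertible and S₁⁻¹ S₂ = [[1, 0, 0], [0, 1, 0], [−ŝ_{31}/(s_{33} 𝒲₁), 0, 1]]. (This is the jump matrix J_{1,2} of the linearizable boundary-condition theorem evaluated at x = t = 0, with ŝ(k) = s(−k).) -/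
open Matrix

/-- The jump matrix J₁,₂ for linearizable boundary conditions, evaluated at x = t = 0
(here sh stands for ŝ, i.e. s(−k)). -/
theorem J12_formula (s sh S : Matrix (Fin 3) (Fin 3) ℂ)
    (hdets : s.det = 1) (hdetS : S.det = 1)
    (h1 : -(s 0 2) * m12 S + s 1 2 * m22 S - s 2 2 * m32 S = 0)
    (h2 : -(sh 0 0) * m12 S + sh 1 0 * m22 S - sh 2 0 * m32 S = 0)
    (h3 : s 0 1 * m13 S - s 1 1 * m23 S + s 2 1 * m33 S = 0)
    (h4 : sh 0 0 * m13 S - sh 1 0 * m23 S + sh 2 0 * m33 S = 0)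
    (hs33 : s 2 2 ≠ 0)
    (h𝒲₁ : sh 0 0 * m11 s - sh 1 0 * m21 s + sh 2 0 * m31 s ≠ 0)
    (hW₁ : S 0 0 * m11 s - S 1 0 * m21 s + S 2 0 * m31 s ≠ 0)
    (hW₂ : m11 s * m22 S - m21 s * m12 S ≠ 0)
    (hnd1 : s 0 2 * sh 1 0 - sh 0 0 * s 1 2 ≠ 0)
    (hnd2 : s 1 1 * sh 0 0 - s 0 1 * sh 1 0 ≠ 0) :
    IsUnit (!![S 0 0 / (S 0 0 * m11 s - S 1 0 * m21 s + S 2 0 * m31 s), m21 s / s 2 2, s 0 2;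
               S 1 0 / (S 0 0 * m11 s - S 1 0 * m21 s + S 2 0 * m31 s), m11 s / s 2 2, s 1 2;
               S 2 0 / (S 0 0 * m11 s - S 1 0 * m21 s + S 2 0 * m31 s), 0, s 2 2]
        : Matrix (Fin 3) (Fin 3) ℂ)
    ∧ (!![S 0 0 / (S 0 0 * m11 s - S 1 0 * m21 s + S 2 0 * m31 s), m21 s / s 2 2, s 0 2;
          S 1 0 / (S 0 0 * m11 s - S 1 0 * m21 s + S 2 0 * m31 s), m11 s / s 2 2, s 1 2;
          S 2 0 / (S 0 0 * m11 s - S 1 0 * m21 s + S 2 0 * m31 s), 0, s 2 2]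
        : Matrix (Fin 3) (Fin 3) ℂ)⁻¹
        * !![m22 S / (m11 s * m22 S - m21 s * m12 S), m21 s / s 2 2, s 0 2;
             m12 S / (m11 s * m22 S - m21 s * m12 S), m11 s / s 2 2, s 1 2;
             0, 0, s 2 2]
      = !![1, 0, 0;
           0, 1, 0;
           -(sh 2 0) / (s 2 2 * (sh 0 0 * m11 s - sh 1 0 * m21 s + sh 2 0 * m31 s)), 0, 1] := by
  have e1 : sh 2 0 * S 0 0 - sh 0 0 * S 2 0 = 0 := by
    rw [Matrix.det_fin_three] at hdetS
    simp only [m11, m12, m13, m21, m22, m23, m31, m32, m33] at h2 h4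
    linear_combination (S 0 0 * S 2 1 - S 0 1 * S 2 0) * h2
      + (S 0 0 * S 2 2 - S 0 2 * S 2 0) * h4 - (sh 2 0 * S 0 0 - sh 0 0 * S 2 0) * hdetS
  have e2 : sh 1 0 * S 2 0 - sh 2 0 * S 1 0 = 0 := by
    rw [Matrix.det_fin_three] at hdetS
    simp only [m11, m12, m13, m21, m22, m23, m31, m32, m33] at h2 h4
    linear_combination -(S 1 0 * S 2 1 - S 1 1 * S 2 0) * h2
      - (S 1 0 * S 2 2 - S 1 2 * S 2 0) * h4 - (sh 1 0 * S 2 0 - sh 2 0 * S 1 0) * hdetS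
  have e3 : (S 0 0 * s 2 2 - S 2 0 * s 0 2) * m12 S
      = (S 1 0 * s 2 2 - S 2 0 * s 1 2) * m22 S := by
    have hu : S 0 0 * m12 S - S 1 0 * m22 S + S 2 0 * m32 S = 0 := by
      simp only [m12, m22, m32]; ring
    linear_combination s 2 2 * hu + S 2 0 * h1
  have e4 : s 0 2 * m11 s - s 1 2 * m21 s + s 2 2 * m31 s = 0 := by
    simp only [m11, m21, m31]; ring
  clear h1 h2 h3 h4 hdets hdetS hnd1 hnd2
  generalize m11 s = a at *
  generalize m21 s = b at *
  generalize m31 s = c at *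
  generalize m12 S = p at *
  generalize m22 S = q at *
  have e5 : sh 2 0 * (S 0 0 * a - S 1 0 * b + S 2 0 * c)
      = S 2 0 * (sh 0 0 * a - sh 1 0 * b + sh 2 0 * c) := by
    linear_combination a * e1 + b * e2
  have e6 : (S 0 0 * s 2 2 - S 2 0 * s 0 2) * (a * q - b * p)
      = s 2 2 * (S 0 0 * a - S 1 0 * b + S 2 0 * c) * q := by
    linear_combination -b * e3 - S 2 0 * q * e4
  have e7 : (S 1 0 * s 2 2 - S 2 0 * s 1 2) * (a * q - b * p)
      = s 2 2 * (S 0 0 * a - S 1 0 * b + S 2 0 * c) * p := by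
    linear_combination -a * e3 - S 2 0 * p * e4
  have e8 : S 0 0 * (a * s 2 2) - S 1 0 * (b * s 2 2) + S 2 0 * (b * s 1 2 - a * s 0 2)
      = s 2 2 * (S 0 0 * a - S 1 0 * b + S 2 0 * c) := by
    linear_combination -S 2 0 * e4
  generalize S 0 0 * a - S 1 0 * b + S 2 0 * c = W at *
  generalize sh 0 0 * a - sh 1 0 * b + sh 2 0 * c = V at *
  generalize a * q - b * p = U at *
  have hx : -(sh 2 0) / (s 2 2 * V) = -(S 2 0) / (s 2 2 * W) := by
    field_simp
    linear_combination -e5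
  rw [hx]
  have hdet : IsUnit (!![S 0 0 / W, b / s 2 2, s 0 2;
      S 1 0 / W, a / s 2 2, s 1 2;
      S 2 0 / W, 0, s 2 2] : Matrix (Fin 3) (Fin 3) ℂ).det := by
    have : (!![S 0 0 / W, b / s 2 2, s 0 2;
      S 1 0 / W, a / s 2 2, s 1 2;
      S 2 0 / W, 0, s 2 2] : Matrix (Fin 3) (Fin 3) ℂ).det = 1 := by
      rw [Matrix.det_fin_three]
      simp
      field_simp
      linear_combination e8
    rw [this]; exact isUnit_one
  refine ⟨(Matrix.isUnit_iff_isUnit_det _).2 hdet, ?_⟩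
  have key : (!![q / U, b / s 2 2, s 0 2; p / U, a / s 2 2, s 1 2; 0, 0, s 2 2] :
      Matrix (Fin 3) (Fin 3) ℂ) = !![S 0 0 / W, b / s 2 2, s 0 2;
      S 1 0 / W, a / s 2 2, s 1 2;
      S 2 0 / W, 0, s 2 2] * !![1, 0, 0; 0, 1, 0; -(S 2 0) / (s 2 2 * W), 0, 1] := by
    have k1 : q / U = S 0 0 / W + s 0 2 * (-(S 2 0) / (s 2 2 * W)) := by
      field_simp
      linear_combination -e6
    have k2 : p / U = S 1 0 / W + s 1 2 * (-(S 2 0) / (s 2 2 * W)) := by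
      field_simp
      linear_combination -e7
    have k3 : 0 = S 2 0 / W + s 2 2 * (-(S 2 0) / (s 2 2 * W)) := by
      field_simp
      ring
    ext i j
    fin_cases i <;> fin_cases j <;> simp [Matrix.mul_apply, Fin.sum_univ_three]
    · exact k1
    · exact k2
    · exact k3
  rw [key, Matrix.nonsing_inv_mul_cancel_left _ _ hdet]
end
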